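/- Let μ be a finite positive Borel measure on ℝ that is uniformly α-Hölder singular for some α ∈ [0,1], i.e., there exist constants C > 0 and 0 < r₀ < 1 such that for all 0 < r < r₀ and μ-almost every x, μ(B(x;r)) ≥ C·r^α. Then there exist finite constants D > 0 and t₀ > 1 such that for every t > t₀, Ξ_μ(t) ≤ μ(ℝ)·D·t^{α/2}, where Ξ_μ(t) := ∫ (∫ e^{-(x-y)²t²/4} dμ(y))^{-1/2} dμ(x). -/

import Mathlib

open MeasureTheory Metric Set Filter
open scoped ENNReal Topology

/-- `Ξ_μ(t) := ∫ dμ(x) (∫ dμ(y) e^{-(x-y)²t²/4})^{-1/2}`. -/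
noncomputable def Xi (mu : Measure ℝ) (t : ℝ) : ℝ :=
  ∫ x, (∫ y, Real.exp (-(x - y) ^ 2 * t ^ 2 / 4) ∂mu) ^ (-(1:ℝ) / 2) ∂mu

theorem uahs_Xi_bound (mu : Measure ℝ) [IsFiniteMeasure mu] (hmu : mu ≠ 0)
    (alpha : ℝ) (halpha : alpha ∈ Set.Icc (0:ℝ) 1)
    (C r₀ : ℝ) (hC : 0 < C) (hr₀ : 0 < r₀) (hr₀' : r₀ < 1)
    (hUHS : ∀ r : ℝ, 0 < r → r < r₀ →
      ∀ᵐ x ∂mu, ENNReal.ofReal (C * r ^ alpha) ≤ mu (Metric.ball x r)) :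
    ∃ D t₀ : ℝ, 0 < D ∧ 1 < t₀ ∧ ∀ t : ℝ, t₀ < t →
      Xi mu t ≤ (mu Set.univ).toReal * D * t ^ (alpha / 2) := by
  refine ⟨(Real.exp (-1/4) * C) ^ (-(1:ℝ)/2), 1 / r₀, by positivity,
    (one_lt_div hr₀).2 hr₀', ?_⟩
  intro t ht
  have ht0 : 0 < t := lt_trans (by positivity) ht
  have hr : 1 / t < r₀ := by
    rw [div_lt_iff₀ hr₀] at ht
    rw [div_lt_iff₀ ht0]
    linarith [mul_comm t r₀]
  have key : ∀ᵐ x ∂mu, (∫ y, Real.exp (-(x - y) ^ 2 * t ^ 2 / 4) ∂mu) ^ (-(1:ℝ) / 2)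
      ≤ (Real.exp (-1/4) * C) ^ (-(1:ℝ)/2) * t ^ (alpha / 2) := by
    filter_upwards [hUHS (1 / t) (by positivity) hr] with x hx
    have hint : Integrable (fun y => Real.exp (-(x - y) ^ 2 * t ^ 2 / 4)) mu := by
      refine Integrable.of_bound (C := 1) (by fun_prop) (Eventually.of_forall fun y => ?_)
      rw [Real.norm_eq_abs, abs_of_pos (Real.exp_pos _), Real.exp_le_one_iff]
      have : 0 ≤ (x - y) ^ 2 * t ^ 2 := by positivity
      linarith
    have hball : C * (1 / t) ^ alpha ≤ mu.real (ball x (1 / t)) := by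
      rw [Measure.real]
      exact (ENNReal.ofReal_le_iff_le_toReal (measure_ne_top _ _)).1 hx
    have h1 : Real.exp (-1/4) * mu.real (ball x (1 / t))
        ≤ ∫ y, Real.exp (-(x - y) ^ 2 * t ^ 2 / 4) ∂mu := by
      refine le_trans ?_ (setIntegral_le_integral (s := ball x (1 / t)) hint
        (Eventually.of_forall fun y => (Real.exp_pos _).le))
      refine setIntegral_ge_of_const_le_real measurableSet_ball (measure_ne_top _ _) ?_
        hint.integrableOn
      intro y hy
      rw [Real.exp_le_exp]
      rw [mem_ball, Real.dist_eq, abs_sub_comm, lt_div_iff₀ ht0] at hy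
      have h2 : (|x - y| * t) ^ 2 ≤ 1 := pow_le_one₀ (by positivity) hy.le
      rw [mul_pow, sq_abs] at h2
      linarith
    have h3 : Real.exp (-1/4) * C * t ^ (-alpha)
        ≤ ∫ y, Real.exp (-(x - y) ^ 2 * t ^ 2 / 4) ∂mu := by
      refine le_trans ?_ h1
      rw [mul_assoc]
      refine mul_le_mul_of_nonneg_left (le_trans (le_of_eq ?_) hball) (Real.exp_pos _).le
      rw [one_div, Real.inv_rpow ht0.le, Real.rpow_neg ht0.le]
    refine (Real.rpow_le_rpow_of_nonpos (by positivity) h3 (by norm_num)).trans (le_of_eq ?_)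
    rw [Real.mul_rpow (by positivity) (by positivity), ← Real.rpow_mul ht0.le]
    congr 2
    ring
  unfold Xi
  refine (integral_mono_of_nonneg (Eventually.of_forall fun x => ?_)
    (integrable_const _) key).trans (le_of_eq ?_)
  · exact Real.rpow_nonneg (integral_nonneg fun y => (Real.exp_pos _).le) _
  · rw [integral_const, smul_eq_mul, Measure.real, mul_assoc]
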